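/- arXiv:2111.12362 — 2 statements merged into one kernel-verified Lean document; each statement's English description precedes it below -/
import Mathlib

section
/- Let M ∈ F_2^{m×n}, b ∈ F_2^m, let G = G(M,b), and let u be a magic unitary over a unital C*-algebra indexed by V(G) satisfying the Qut(G) relations. Then: (i) u_{(l,α),(k,β)} = 0 whenever l ≠ k; (ii) for each k ∈ [m] and all α,β,α′,β′ ∈ ±1^{S_k}_{b_k} with α△β = α′△β′, one has u_{(k,α),(k,β)} = u_{(k,α′),(k,β′)}; (iii) for each fixed k ∈ [m], the elements u_{(k,α),(k,β)} (α,β ∈ ±1^{S_k}_{b_k}) pairwise commute. -/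
open scoped BigOperators

/-- A magic unitary over a ring with star: every entry is a projection and
every row and column sums to `1`. -/
def IsMagicUnitary {I J A : Type*} [Fintype I] [Fintype J] [Ring A] [StarRing A]
    (u : I → J → A) : Prop :=
  (∀ i j, star (u i j) = u i j) ∧ (∀ i j, u i j * u i j = u i j) ∧
    (∀ i, ∑ j, u i j = 1) ∧ (∀ j, ∑ i, u i j = 1)

/-- The sign `(-1)^x` for `x ∈ F₂`. -/
def signZ (x : ZMod 2) : ℤˣ := if x = 0 then 1 else -1

/-- `S_k = {i : M k i = 1}`. -/
def Sk {m n : ℕ} (M : Matrix (Fin m) (Fin n) (ZMod 2)) (k : Fin m) : Finset (Fin n) :=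
  Finset.univ.filter fun i => M k i = 1

/-- The vertex set of the colored graph `G(M,b)`: pairs `(k, α)` where
`α : ±1^{S_k}` with `∏_{i ∈ S_k} α i = (-1)^{b k}`, encoded as functions on `Fin n`
normalized to `1` off `S_k`. -/
abbrev GVertex {m n : ℕ} (M : Matrix (Fin m) (Fin n) (ZMod 2)) (b : Fin m → ZMod 2) : Type :=
  {p : Fin m × (Fin n → ℤˣ) //
    (∀ i, i ∉ Sk M p.1 → p.2 i = 1) ∧ ∏ i ∈ Sk M p.1, p.2 i = signZ (b p.1)}

/-- `v` and `w` are joined by an edge of color `({l,k}, δ|_{S_l ∩ S_k})` in `G(M,b)`. -/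
def adjC {m n : ℕ} (M : Matrix (Fin m) (Fin n) (ZMod 2)) (b : Fin m → ZMod 2)
    (l k : Fin m) (δ : Fin n → ℤˣ) (v w : GVertex M b) : Prop :=
  ((v.1.1 = l ∧ w.1.1 = k) ∨ (v.1.1 = k ∧ w.1.1 = l)) ∧ v ≠ w ∧
    (Sk M l ∩ Sk M k).Nonempty ∧
    ∀ i ∈ Sk M l ∩ Sk M k, v.1.2 i * w.1.2 i = δ i

open Classical in
/-- The 0/1 adjacency matrix (with entries in `A`) of the color class
`({l,k}, δ|_{S_l ∩ S_k})` of the colored graph `G(M,b)`. -/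
noncomputable def adjMat (A : Type*) [Zero A] [One A] {m n : ℕ}
    (M : Matrix (Fin m) (Fin n) (ZMod 2)) (b : Fin m → ZMod 2)
    (l k : Fin m) (δ : Fin n → ℤˣ) (v w : GVertex M b) : A :=
  if adjC M b l k δ v w then 1 else 0

/-- `u` satisfies the `Qut(G(M,b))` relations: entries vanish between distinct
vertex colors, and `u` commutes with every edge-color adjacency matrix. -/
def QutRel (A : Type*) [Ring A] {m n : ℕ} (M : Matrix (Fin m) (Fin n) (ZMod 2))
    (b : Fin m → ZMod 2) (u : GVertex M b → GVertex M b → A) : Prop :=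
  (∀ v w : GVertex M b, v.1.1 ≠ w.1.1 → u v w = 0) ∧
  ∀ (l k : Fin m) (δ : Fin n → ℤˣ) (v w : GVertex M b),
    ∑ x, adjMat A M b l k δ v x * u x w = ∑ x, u v x * adjMat A M b l k δ x w

section CStarRing

variable {A : Type*} [NormedRing A] [StarRing A] [CStarRing A]

theorem norm_le_one_of_forall_norm_pow_le {x : A} (hx : IsSelfAdjoint x) {C : ℝ}
    (h : ∀ k, ‖x ^ 2 ^ k‖ ≤ C) : ‖x‖ ≤ 1 := by
  by_contra! hlt
  obtain ⟨k, hk⟩ := pow_unbounded_of_one_lt C hlt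
  have hle : ‖x‖ ^ k ≤ ‖x‖ ^ 2 ^ k := pow_le_pow_right₀ hlt.le k.lt_two_pow_self.le
  have hC := h k
  rw [hx.norm_pow_two_pow] at hC
  linarith

theorem norm_one_sub_mul_mul_le {p q : A} (hp : IsStarProjection p) (hq : IsStarProjection q) :
    ‖1 - p * q * p‖ ≤ 1 := by
  have hpp : p * p = p := hp.isIdempotentElem
  set y := p * (1 - q) * p with hy
  have hpy : p * y = y := by rw [hy, ← mul_assoc, ← mul_assoc, hpp]
  have hyp : y * p = y := by rw [hy, mul_assoc, hpp]
  have hx : 1 - p * q * p = (1 - p) + y := by rw [hy, mul_sub, sub_mul, mul_one, hpp]; abel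
  have hyn : ‖y‖ ≤ 1 :=
    calc ‖y‖ ≤ ‖p‖ * ‖1 - q‖ * ‖p‖ := norm_mul₃_le
      _ ≤ 1 * 1 * 1 := by
        gcongr
        exacts [hp.norm_le, hq.one_sub.norm_le, hp.norm_le]
      _ = 1 := by norm_num
  have hpow (k : ℕ) : ((1 - p) + y) ^ (k + 1) = (1 - p) + y ^ (k + 1) := by
    induction k with
    | zero => simp
    | succ k ih =>
      have hyk : y ^ (k + 1) * p = y ^ (k + 1) := by rw [pow_succ, mul_assoc, hyp]
      rw [pow_succ, ih, pow_succ y (k + 1), add_mul, mul_add, mul_add, mul_sub (y ^ (k + 1)),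
        mul_one, hyk, sub_mul 1 p y, hpy, hp.isIdempotentElem.one_sub.eq]
      simp
  have hsa : IsSelfAdjoint (1 - p * q * p) := by
    rw [IsSelfAdjoint, star_sub, star_one, star_mul, star_mul, hp.isSelfAdjoint.star_eq,
      hq.isSelfAdjoint.star_eq, mul_assoc]
  refine norm_le_one_of_forall_norm_pow_le (C := 2) hsa fun k => ?_
  obtain ⟨r, hr⟩ := Nat.exists_eq_succ_of_ne_zero (pow_ne_zero k two_ne_zero)
  rw [hr, hx, Nat.succ_eq_add_one, hpow]
  calc ‖(1 - p) + y ^ (r + 1)‖ ≤ ‖1 - p‖ + ‖y ^ (r + 1)‖ := norm_add_le _ _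
    _ ≤ 1 + ‖y‖ ^ (r + 1) := add_le_add hp.one_sub.norm_le (norm_pow_le' y r.succ_pos)
    _ ≤ 1 + 1 := by gcongr; exact pow_le_one₀ (norm_nonneg y) hyn
    _ = 2 := by norm_num

variable [NormedAlgebra ℂ A] [CompleteSpace A]

/-- The star operation is not assumed to be conjugate-linear here. -/
theorem spectralRadius_eq_nnnorm_of_isSelfAdjoint {a : A} (ha : IsSelfAdjoint a) :
    spectralRadius ℂ a = ‖a‖₊ := by
  refine tendsto_nhds_unique ?_
    (tendsto_const_nhds (x := (‖a‖₊ : ENNReal)) (f := (Filter.atTop : Filter ℕ)))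
  convert! (spectrum.pow_nnnorm_pow_one_div_tendsto_nhds_spectralRadius a).comp
      (tendsto_pow_atTop_atTop_of_one_lt one_lt_two) using 1
  refine funext fun n => ?_
  rw [Function.comp_apply, ha.nnnorm_pow_two_pow, ENNReal.coe_pow, ← ENNReal.rpow_natCast,
    ← ENNReal.rpow_mul]
  simp

theorem eq_zero_of_norm_one_sub_le_of_norm_add_le [Nontrivial A] {c : A} (hc : IsSelfAdjoint c)
    (K : ℕ) (h₁ : ‖1 - c‖ ≤ 1) (h₂ : ‖(K : A) + c‖ ≤ K) : c = 0 := by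
  have hz : ∀ z ∈ spectrum ℂ c, z = 0 := by
    intro z hz
    have hm₁ : 1 - z ∈ spectrum ℂ (1 - c) := by
      rw [← map_one (algebraMap ℂ A), ← spectrum.singleton_sub_eq]
      exact Set.sub_mem_sub rfl hz
    have hm₂ : z + K ∈ spectrum ℂ ((K : A) + c) := by
      rw [← map_natCast (algebraMap ℂ A)]
      exact spectrum.add_mem_add_iff.2 hz
    have hb₁ := (spectrum.norm_le_norm_of_mem hm₁).trans h₁
    have hb₂ := (spectrum.norm_le_norm_of_mem hm₂).trans h₂
    have hK : (0 : ℝ) ≤ K := K.cast_nonneg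
    rw [← sq_le_sq₀ (norm_nonneg _) zero_le_one, ← Complex.normSq_eq_norm_sq,
      Complex.normSq_apply] at hb₁
    rw [← sq_le_sq₀ (norm_nonneg _) hK, ← Complex.normSq_eq_norm_sq,
      Complex.normSq_apply] at hb₂
    simp only [Complex.sub_re, Complex.one_re, Complex.sub_im, Complex.one_im, Complex.add_re,
      Complex.natCast_re, Complex.add_im, Complex.natCast_im] at hb₁ hb₂
    have hle : Complex.normSq z ≤ 0 := by
      rw [Complex.normSq_apply]
      rcases le_total z.re 0 with h | h
      · nlinarith
      · nlinarith [mul_nonneg hK h]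
    exact Complex.normSq_eq_zero.1 (hle.antisymm (Complex.normSq_nonneg z))
  have hr : spectralRadius ℂ c = 0 := by
    rw [spectralRadius]
    simp only [ENNReal.iSup_eq_zero]
    intro z hmem
    simp [hz z hmem]
  rw [spectralRadius_eq_nnnorm_of_isSelfAdjoint hc] at hr
  simpa using hr

/-- Star projections that sum to `1` are pairwise orthogonal. -/
theorem mul_eq_zero_of_sum_eq_one {ι : Type*} [Fintype ι] {p : ι → A}
    (hp : ∀ i, IsStarProjection (p i)) (hsum : ∑ i, p i = 1) {i j : ι} (hij : i ≠ j) :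
    p i * p j = 0 := by
  classical
  nontriviality A
  let c (l : ι) : A := p j * p l * p j
  have hjj : p j * p j = p j := (hp j).isIdempotentElem
  have hc : ∑ l ∈ Finset.univ.erase j, c l = 0 := by
    have h : c j + ∑ l ∈ Finset.univ.erase j, c l = p j := by
      rw [Finset.add_sum_erase _ _ (Finset.mem_univ j), ← Finset.sum_mul, ← Finset.mul_sum, hsum,
        mul_one, hjj]
    rwa [show c j = p j by simp only [c, hjj], add_eq_left] at h
  have hci : c i + ∑ l ∈ (Finset.univ.erase j).erase i, c l = 0 := by
    rw [Finset.add_sum_erase _ _ (by simp [hij]), hc]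
  have hstar : star (p i * p j) * (p i * p j) = c i := by
    rw [star_mul, (hp i).isSelfAdjoint.star_eq, (hp j).isSelfAdjoint.star_eq, mul_assoc,
      ← mul_assoc (p i), (hp i).isIdempotentElem.eq, ← mul_assoc]
  have hzero : c i = 0 := by
    refine eq_zero_of_norm_one_sub_le_of_norm_add_le (hstar ▸ IsSelfAdjoint.star_mul_self _)
      ((Finset.univ.erase j).erase i).card (norm_one_sub_mul_mul_le (hp j) (hp i)) ?_
    have h : ((((Finset.univ.erase j).erase i).card : ℕ) : A) + c i =
        ∑ l ∈ (Finset.univ.erase j).erase i, (1 - c l) := by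
      rw [Finset.sum_sub_distrib, eq_neg_of_add_eq_zero_left hci]
      simp [sub_eq_add_neg]
    rw [h]
    refine (norm_sum_le_of_le _ fun l _ => norm_one_sub_mul_mul_le (hp j) (hp l)).trans ?_
    simp
  rw [← CStarRing.star_mul_self_eq_zero_iff, hstar, hzero]

end CStarRing

section GVertex

variable {m n : ℕ} {M : Matrix (Fin m) (Fin n) (ZMod 2)} {b : Fin m → ZMod 2}

theorem GVertex.ext_of_eqOn {v w : GVertex M b} (hc : v.1.1 = w.1.1)
    (h : ∀ i ∈ Sk M v.1.1, v.1.2 i = w.1.2 i) : v = w := by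
  refine Subtype.ext (Prod.ext hc (funext fun i => ?_))
  by_cases hi : i ∈ Sk M v.1.1
  · exact h i hi
  · rw [v.2.1 i hi, w.2.1 i (hc ▸ hi)]

theorem GVertex.exists_mul_mul {v v' w : GVertex M b} (hv : v.1.1 = w.1.1)
    (hv' : v'.1.1 = w.1.1) :
    ∃ x : GVertex M b, x.1.1 = w.1.1 ∧ ∀ i, x.1.2 i = v.1.2 i * v'.1.2 i * w.1.2 i := by
  refine ⟨⟨(w.1.1, fun i => v.1.2 i * v'.1.2 i * w.1.2 i), fun i hi => ?_, ?_⟩, rfl, fun _ => rfl⟩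
  · change v.1.2 i * v'.1.2 i * w.1.2 i = 1
    rw [v.2.1 i (hv ▸ hi), v'.2.1 i (hv' ▸ hi), w.2.1 i hi, one_mul, one_mul]
  · have h₁ := v.2.2
    have h₂ := v'.2.2
    rw [hv] at h₁
    rw [hv'] at h₂
    simp only [Finset.prod_mul_distrib]
    rw [h₁, h₂, w.2.2, Int.units_mul_self, one_mul]

theorem adjC_self_comm {k : Fin m} {δ : Fin n → ℤˣ} {v w : GVertex M b} :
    adjC M b k k δ v w ↔ adjC M b k k δ w v := by
  simp only [adjC, ne_comm (a := v), mul_comm (v.1.2 _), and_comm (a := v.1.1 = k)]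

/-- Within one color, each edge color determines at most one neighbor of a vertex. -/
theorem adjC_self_iff {δ : Fin n → ℤˣ} {v w x : GVertex M b} (hne : v ≠ w)
    (hw : w.1.1 = v.1.1) (hδ : ∀ i ∈ Sk M v.1.1, v.1.2 i * w.1.2 i = δ i) :
    adjC M b v.1.1 v.1.1 δ v x ↔ x = w := by
  simp only [adjC, Finset.inter_self, or_self, true_and]
  refine ⟨fun ⟨hx, _, _, h⟩ => ?_, ?_⟩
  · refine GVertex.ext_of_eqOn (hx.trans hw.symm) fun i hi => ?_
    rw [hx] at hi
    exact mul_left_cancel ((h i hi).trans (hδ i hi).symm)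
  · rintro rfl
    refine ⟨hw, hne, ?_, hδ⟩
    by_contra hemp
    rw [Finset.not_nonempty_iff_eq_empty] at hemp
    exact hne (GVertex.ext_of_eqOn hw.symm (by simp [hemp]))

theorem QutRel.apply_eq_apply {A : Type*} [Ring A] {u : GVertex M b → GVertex M b → A}
    (hu : QutRel A M b u) {v w v' w' : GVertex M b} (hw : v.1.1 = w.1.1)
    (hv' : v'.1.1 = v.1.1) (hw' : w'.1.1 = v.1.1)
    (h : ∀ i ∈ Sk M v.1.1, v.1.2 i * w.1.2 i = v'.1.2 i * w'.1.2 i) : u v w = u v' w' := by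
  classical
  have hcross : ∀ i ∈ Sk M v.1.1, w'.1.2 i * w.1.2 i = v.1.2 i * v'.1.2 i := by
    intro i hi
    calc w'.1.2 i * w.1.2 i = w'.1.2 i * (v.1.2 i * (v.1.2 i * w.1.2 i)) := by
          rw [← mul_assoc (v.1.2 i), Int.units_mul_self, one_mul]
      _ = v.1.2 i * v'.1.2 i * (w'.1.2 i * w'.1.2 i) := by
          rw [h i hi]; ac_rfl
      _ = v.1.2 i * v'.1.2 i := by rw [Int.units_mul_self, mul_one]
  by_cases hv : v = v'
  · subst hv
    rw [GVertex.ext_of_eqOn (v := w) (w := w') (hw.symm.trans hw'.symm)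
      fun i hi => mul_left_cancel (h i (hw ▸ hi))]
  have hwne : w' ≠ w := by
    rintro rfl
    exact hv (GVertex.ext_of_eqOn hv'.symm fun i hi => mul_right_cancel (h i hi))
  have hrel := hu.2 v.1.1 v.1.1 (fun i => v.1.2 i * v'.1.2 i) v w'
  have hl (x : GVertex M b) : adjC M b v.1.1 v.1.1 (fun i => v.1.2 i * v'.1.2 i) v x ↔ x = v' :=
    adjC_self_iff hv hv' fun _ _ => rfl
  have hr (x : GVertex M b) : adjC M b v.1.1 v.1.1 (fun i => v.1.2 i * v'.1.2 i) x w' ↔ x = w := by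
    rw [adjC_self_comm, ← hw']
    exact adjC_self_iff hwne (hw.symm.trans hw'.symm) (hw'.symm ▸ hcross)
  simp only [adjMat, hl, hr] at hrel
  simpa using hrel.symm

end GVertex

/-- Lemma 3.5 (block structure of the fundamental representation of `Qut(G(M,b))`):
(i) entries between different blocks vanish; (ii) within the `k`-th block the entry
`u_{(k,α),(k,β)}` only depends on `α △ β`; (iii) the entries of each block pairwise
commute. -/
theorem qutGdecomp {m n : ℕ} (M : Matrix (Fin m) (Fin n) (ZMod 2)) (b : Fin m → ZMod 2)
    {A : Type*} [NormedRing A] [StarRing A] [CStarRing A] [NormedAlgebra ℂ A]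
    [CompleteSpace A]
    (u : GVertex M b → GVertex M b → A)
    (hmu : IsMagicUnitary u) (hqut : QutRel A M b u) :
    (∀ v w : GVertex M b, v.1.1 ≠ w.1.1 → u v w = 0) ∧
    (∀ v w v' w' : GVertex M b,
      v.1.1 = w.1.1 → v'.1.1 = v.1.1 → w'.1.1 = v.1.1 →
      (∀ i ∈ Sk M v.1.1, v.1.2 i * w.1.2 i = v'.1.2 i * w'.1.2 i) →
      u v w = u v' w') ∧
    (∀ v w v' w' : GVertex M b,
      v.1.1 = w.1.1 → v'.1.1 = v.1.1 → w'.1.1 = v.1.1 →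
      u v w * u v' w' = u v' w' * u v w) := by
  refine ⟨hqut.1, fun v w v' w' => hqut.apply_eq_apply, fun v w v' w' hw hv' hw' => ?_⟩
  obtain ⟨hstar, hidem, hrow, -⟩ := hmu
  obtain ⟨x, hx, hxi⟩ := GVertex.exists_mul_mul (v := v) (v' := v') (w := w') hw'.symm
    (hv'.trans hw'.symm)
  have hux : u v x = u v' w' := by
    refine hqut.apply_eq_apply (hw'.symm.trans hx.symm) hv' hw' fun i _ => ?_
    rw [hxi, mul_assoc, ← mul_assoc, Int.units_mul_self, one_mul]
  rw [← hux]
  by_cases hwx : w = x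
  · rw [hwx]
  have hproj (y : GVertex M b) : IsStarProjection (u v y) := ⟨hidem v y, hstar v y⟩
  rw [mul_eq_zero_of_sum_eq_one hproj (hrow v) hwx,
    mul_eq_zero_of_sum_eq_one hproj (hrow v) (Ne.symm hwx)]
end

section
/- Let M ∈ F_2^{m×n}, let x_1,…,x_n be elements of a unital C*-algebra A satisfying the homogeneous solution group relations for M, and let b ∈ F_2^m. For δ ∈ ±1^{S_k} set v^{(k)}_δ = ∏_{i∈S_k} (1 + δ_i x_i)/2 (product in increasing order of indices). Define the matrix v indexed by V(G(M,b)) by v_{(l,α),(k,β)} = 0 if l ≠ k and v_{(k,α),(k,β)} = v^{(k)}_{α△β}. Then v is a magic unitary over A satisfying the Qut(G(M,b)) relations. -/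
open scoped BigOperators

/-- `x : Fin n → A` satisfies the homogeneous solution group relations for `M`:
each `x i` is a self-adjoint involution, `x i` and `x j` commute whenever
`i, j ∈ S_k` for some `k`, and `∏_{i ∈ S_k} x i = 1` (in increasing order) for all `k`. -/
def SolRel {m n : ℕ} {A : Type*} [Ring A] [StarRing A]
    (M : Matrix (Fin m) (Fin n) (ZMod 2)) (x : Fin n → A) : Prop :=
  (∀ i, star (x i) = x i) ∧ (∀ i, x i * x i = 1) ∧
    (∀ (k : Fin m) (i j : Fin n), i ∈ Sk M k → j ∈ Sk M k → x i * x j = x j * x i) ∧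
    (∀ k : Fin m, (((Sk M k).sort (· ≤ ·)).map x).prod = 1)

/-- `v^{(k)}_α = ∏_{i ∈ S_k} (1 + α_i x_i)/2`, product in increasing order of indices. -/
noncomputable def vproj {m n : ℕ} {A : Type*} [Ring A] [Algebra ℂ A]
    (M : Matrix (Fin m) (Fin n) (ZMod 2)) (x : Fin n → A)
    (k : Fin m) (α : Fin n → ℤˣ) : A :=
  (((Sk M k).sort (· ≤ ·)).map (fun i => ((2 : ℂ)⁻¹) • (1 + ((α i : ℤ) • x i)))).prod

/-- The idempotent `(1 + a y) / 2` attached to an involution `y` and a sign `a`. -/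
noncomputable def signProj {A : Type*} [Ring A] [Algebra ℂ A] (y : A) (a : ℤˣ) : A :=
  ((2 : ℂ)⁻¹) • (1 + ((a : ℤ) • y))

/-- The product of the `signProj (x i) (ε i)` over `T`, in increasing order. -/
noncomputable def sortedProj {n : ℕ} {A : Type*} [Ring A] [Algebra ℂ A]
    (x : Fin n → A) (T : Finset (Fin n)) (ε : Fin n → ℤˣ) : A :=
  ((T.sort (· ≤ ·)).map fun i => signProj (x i) (ε i)).prod

theorem vproj_eq_sortedProj {m n : ℕ} {A : Type*} [Ring A] [Algebra ℂ A]
    (M : Matrix (Fin m) (Fin n) (ZMod 2)) (x : Fin n → A) (k : Fin m) (α : Fin n → ℤˣ) :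
    vproj M x k α = sortedProj x (Sk M k) α := rfl

theorem star_list_map_prod {ι A : Type*} [Ring A] [StarRing A] (f : ι → A) (l : List ι) :
    star (l.map f).prod = (l.reverse.map fun i => star (f i)).prod := by
  induction l with
  | nil => simp
  | cons a l ih => simp [ih]

theorem adjC_symm {m n : ℕ} {M : Matrix (Fin m) (Fin n) (ZMod 2)} {b : Fin m → ZMod 2}
    {l k : Fin m} {δ : Fin n → ℤˣ} {v w : GVertex M b}
    (h : adjC M b l k δ v w) : adjC M b l k δ w v :=
  ⟨h.1.symm.imp And.symm And.symm, h.2.1.symm, h.2.2.1,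
    fun i hi => by rw [mul_comm, h.2.2.2 i hi]⟩

theorem adjMat_comm {m n : ℕ} {A : Type*} [Zero A] [One A]
    {M : Matrix (Fin m) (Fin n) (ZMod 2)} {b : Fin m → ZMod 2} (l k : Fin m) (δ : Fin n → ℤˣ) (v w : GVertex M b) :
    adjMat A M b l k δ v w = adjMat A M b l k δ w v := by
  classical
  rw [adjMat, adjMat]
  exact if_congr ⟨adjC_symm, adjC_symm⟩ rfl rfl

section Algebra

variable {A : Type*} [Ring A] [Algebra ℂ A]

theorem map_signProj {R : Type*} [Ring R] [Algebra ℂ R] (φ : R →ₐ[ℂ] A) (y : R) (a : ℤˣ) :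
    φ (signProj y a) = signProj (φ y) a := by
  simp [signProj]

theorem eq_inv_two_smul {a c : A} (h : a + a = c) : a = (2 : ℂ)⁻¹ • c := by
  rw [← h, ← two_smul ℂ a, smul_smul]; norm_num

theorem eq_zero_of_add_self {a : A} (h : a + a = 0) : a = 0 := by
  simpa using eq_inv_two_smul h

theorem star_inv_two_smul [StarRing A] (a : A) :
    star ((2 : ℂ)⁻¹ • a) = (2 : ℂ)⁻¹ • star a := by
  refine eq_inv_two_smul ?_
  rw [← star_add, ← add_smul]
  norm_num

theorem star_signProj [StarRing A] {y : A} (hy : star y = y) (a : ℤˣ) :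
    star (signProj y a) = signProj y a := by
  rw [signProj, star_inv_two_smul, star_add, star_one]
  rcases Int.units_eq_one_or a with rfl | rfl <;> simp [hy]

theorem signProj_mul_self {y : A} (hy : y * y = 1) (a : ℤˣ) :
    signProj y a * signProj y a = signProj y a := by
  rw [signProj, smul_mul_smul_comm]
  have h : (1 + (a : ℤ) • y) * (1 + (a : ℤ) • y) = (2 : ℂ) • (1 + (a : ℤ) • y) := by
    rw [two_smul]
    rcases Int.units_eq_one_or a with rfl | rfl <;> simp [mul_add, add_mul, hy]
    abel
  rw [h, smul_smul]
  norm_num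

theorem mul_signProj {y : A} (hy : y * y = 1) (a : ℤˣ) :
    y * signProj y a = ((a : ℤ) : A) * signProj y a := by
  rw [signProj, mul_smul_comm, mul_smul_comm]
  congr 1
  rcases Int.units_eq_one_or a with rfl | rfl <;> simp [mul_add, hy, add_comm]

theorem sum_signProj (y : A) : ∑ a : ℤˣ, signProj y a = 1 := by
  have h : (Finset.univ : Finset ℤˣ) = {1, -1} := rfl
  rw [h, Finset.sum_pair (by decide), signProj, signProj, ← smul_add]
  refine (eq_inv_two_smul ?_).symm
  simp only [Units.val_one, one_smul, Units.val_neg, neg_smul]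
  abel

end Algebra

section Commutative

variable {ι R : Type*} [CommRing R] [Algebra ℂ R]

theorem prod_signProj_eq_zero {y : ι → R} (hy : ∀ i, y i * y i = 1) {S : Finset ι}
    (hS : ∏ i ∈ S, y i = 1) {β : ι → ℤˣ} (hβ : ∏ i ∈ S, β i ≠ 1) :
    ∏ i ∈ S, signProj (y i) (β i) = 0 := by
  have h1 : ∏ i ∈ S, signProj (y i) (β i) =
      ((∏ i ∈ S, β i : ℤˣ) : ℤ) * ∏ i ∈ S, signProj (y i) (β i) := by
    conv_lhs => rw [← one_mul (∏ i ∈ S, _), ← hS, ← Finset.prod_mul_distrib]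
    rw [Units.coe_prod, Int.cast_prod, ← Finset.prod_mul_distrib]
    exact Finset.prod_congr rfl fun i _ => mul_signProj (hy i) _
  rw [(Int.units_eq_one_or _).resolve_left hβ] at h1
  refine eq_zero_of_add_self ?_
  nth_rewrite 1 [h1]
  simp

/-- The sign patterns supported on `S` and agreeing with `ε` on `T`. -/
def signPatterns [Fintype ι] [DecidableEq ι] (S T : Finset ι) (ε : ι → ℤˣ) : Finset (ι → ℤˣ) :=
  Fintype.piFinset fun i => if i ∈ S then (if i ∈ T then {ε i} else Finset.univ) else {1}

theorem mem_signPatterns [Fintype ι] [DecidableEq ι] {S T : Finset ι} (hT : T ⊆ S) {ε β : ι → ℤˣ} :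
    β ∈ signPatterns S T ε ↔ (∀ i, i ∉ S → β i = 1) ∧ ∀ i ∈ T, β i = ε i := by
  rw [signPatterns, Fintype.mem_piFinset]
  constructor
  · intro h
    exact ⟨fun i hi => by simpa [hi] using h i, fun i hi => by simpa [hi, hT hi] using h i⟩
  · rintro ⟨h1, h2⟩ i
    by_cases hS : i ∈ S
    · by_cases hi : i ∈ T
      · simp [hS, hi, h2]
      · simp only [hS, hi, if_true, if_false, Finset.mem_univ]
    · simp [hS, h1 i hS]

theorem sum_signPatterns [Fintype ι] [DecidableEq ι] (y : ι → R) {S T : Finset ι}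
    (hT : T ⊆ S) (ε : ι → ℤˣ) :
    ∑ β ∈ signPatterns S T ε, ∏ i ∈ S, signProj (y i) (β i) =
      ∏ i ∈ T, signProj (y i) (ε i) := by
  have h (β : ι → ℤˣ) : ∏ i ∈ S, signProj (y i) (β i) =
      ∏ i, if i ∈ S then signProj (y i) (β i) else 1 := by
    simp
  simp only [h, signPatterns]
  rw [← Finset.prod_univ_sum _ fun i a => if i ∈ S then signProj (y i) a else 1,
    ← Finset.prod_subset (Finset.subset_univ T)]
  · exact Finset.prod_congr rfl fun i hi => by simp [hi, hT hi]
  · intro i _ hi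
    by_cases hS : i ∈ S
    · simpa only [hS, hi, if_true, if_false] using sum_signProj (y i)
    · simp [hS]

end Commutative

section SolutionGroup

universe u

variable {m n : ℕ} {A : Type u} [Ring A] [Algebra ℂ A]
  {M : Matrix (Fin m) (Fin n) (ZMod 2)} {x : Fin n → A}

theorem map_prod_eq_sort {R : Type*} [CommRing R] [Algebra ℂ R] (φ : R →ₐ[ℂ] A)
    (T : Finset (Fin n)) (f : Fin n → R) :
    φ (∏ i ∈ T, f i) = ((T.sort (· ≤ ·)).map fun i => φ (f i)).prod := by
  rw [← Finset.sort_toFinset (· ≤ ·) (s := T), List.prod_toFinset _ (Finset.sort_nodup _ _),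
    map_list_prod, List.map_map, Finset.sort_toFinset]
  rfl

theorem map_prod_signProj {R : Type*} [CommRing R] [Algebra ℂ R] (φ : R →ₐ[ℂ] A)
    {y : Fin n → R} {T : Finset (Fin n)} (h : ∀ i ∈ T, φ (y i) = x i) (ε : Fin n → ℤˣ) :
    φ (∏ i ∈ T, signProj (y i) (ε i)) = sortedProj x T ε := by
  rw [map_prod_eq_sort, sortedProj]
  refine congrArg List.prod (List.map_congr_left fun i hi => ?_)
  rw [map_signProj, h i ((Finset.mem_sort _).1 hi)]

theorem vproj_ite_comm {b : Fin m → ZMod 2} (v w : GVertex M b) :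
    (if v.1.1 = w.1.1 then vproj M x v.1.1 (fun i => v.1.2 i * w.1.2 i) else 0) =
      if w.1.1 = v.1.1 then vproj M x w.1.1 (fun i => w.1.2 i * v.1.2 i) else 0 := by
  by_cases h : v.1.1 = w.1.1
  · simp [h, mul_comm]
  · simp [h, Ne.symm h]

variable [StarRing A]

open scoped IsMulCommutative in
/-- The generators occurring in one equation live in a commutative algebra. -/
theorem SolRel.exists_commRing (hx : SolRel M x) (k : Fin m) :
    ∃ (R : Type u) (_ : CommRing R) (_ : Algebra ℂ R) (φ : R →ₐ[ℂ] A) (y : Fin n → R),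
      (∀ i ∈ Sk M k, φ (y i) = x i) ∧ (∀ i, y i * y i = 1) ∧
        ∏ i ∈ Sk M k, y i = 1 := by
  classical
  have hc : ∀ a ∈ x '' (Sk M k : Set (Fin n)), ∀ c ∈ x '' (Sk M k : Set (Fin n)),
      a * c = c * a := by
    rintro _ ⟨i, hi, rfl⟩ _ ⟨j, hj, rfl⟩
    exact hx.2.2.1 k i j hi hj
  have := Algebra.isMulCommutative_adjoin ℂ hc
  let y : Fin n → Algebra.adjoin ℂ (x '' (Sk M k : Set (Fin n))) := fun i =>
    if h : i ∈ Sk M k then ⟨x i, Algebra.subset_adjoin ⟨i, h, rfl⟩⟩ else 1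
  have hy : ∀ i ∈ Sk M k, (y i : A) = x i := fun i hi => by simp [y, hi]
  refine ⟨_, inferInstance, inferInstance, Subalgebra.val _, y, hy, fun i => ?_, ?_⟩
  · by_cases h : i ∈ Sk M k
    · exact Subtype.ext (by simp [hy i h, hx.2.1 i])
    · simp [y, h]
  · refine Subtype.ext ?_
    change Subalgebra.val _ (∏ i ∈ Sk M k, y i) = 1
    rw [map_prod_eq_sort, ← hx.2.2.2 k]
    exact congrArg List.prod (List.map_congr_left fun i hi => hy i ((Finset.mem_sort _).1 hi))

theorem SolRel.star_sortedProj (hx : SolRel M x) (k : Fin m) (ε : Fin n → ℤˣ) :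
    star (sortedProj x (Sk M k) ε) = sortedProj x (Sk M k) ε := by
  rw [sortedProj, star_list_map_prod]
  simp only [star_signProj (hx.1 _)]
  refine (List.reverse_perm _).map _ |>.prod_eq' ?_
  refine List.Pairwise.map _ (fun _ _ h => h) (List.Pairwise.imp_of_mem (R := fun _ _ => True)
    (fun {i j} hi hj _ => ?_) (List.pairwise_of_forall fun _ _ => trivial))
  simp only [List.mem_reverse, Finset.mem_sort] at hi hj
  have h : Commute (x i) (x j) := hx.2.2.1 k i j hi hj
  exact ((((Commute.one_left _).add_left
    ((((Commute.one_right _).add_right (h.smul_right _))).smul_left _)).smul_left _).smul_right _)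

theorem SolRel.sortedProj_mul_self (hx : SolRel M x) (k : Fin m) (ε : Fin n → ℤˣ) :
    sortedProj x (Sk M k) ε * sortedProj x (Sk M k) ε = sortedProj x (Sk M k) ε := by
  obtain ⟨R, _, _, φ, y, hyx, hy, -⟩ := hx.exists_commRing k
  rw [← map_prod_signProj φ hyx, ← map_mul, ← Finset.prod_mul_distrib]
  simp only [signProj_mul_self (hy _)]

theorem SolRel.sum_signPatterns_sortedProj (hx : SolRel M x) {k : Fin m}
    {T : Finset (Fin n)} (hT : T ⊆ Sk M k) (ε : Fin n → ℤˣ) :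
    ∑ β ∈ signPatterns (Sk M k) T ε with ∏ i ∈ Sk M k, β i = 1, sortedProj x (Sk M k) β =
      sortedProj x T ε := by
  obtain ⟨R, _, _, φ, y, hyx, hy, hS⟩ := hx.exists_commRing k
  rw [← map_prod_signProj φ fun i hi => hyx i (hT hi), ← sum_signPatterns y hT, map_sum]
  simp only [map_prod_signProj φ hyx]
  refine Finset.sum_filter_of_ne fun β _ h => ?_
  by_contra hβ
  exact h (by rw [← map_prod_signProj φ hyx, prod_signProj_eq_zero hy hS hβ, map_zero])

open Classical in
theorem SolRel.sum_vertices (hx : SolRel M x) {b : Fin m → ZMod 2} (w : GVertex M b)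
    {T : Finset (Fin n)} (hT : T ⊆ Sk M w.1.1) (ε : Fin n → ℤˣ) :
    (∑ v : GVertex M b, if v.1.1 = w.1.1 ∧ ∀ i ∈ T, v.1.2 i * w.1.2 i = ε i then
      vproj M x v.1.1 (fun i => v.1.2 i * w.1.2 i) else 0) = sortedProj x T ε := by
  rw [← hx.sum_signPatterns_sortedProj hT, ← Finset.sum_filter]
  obtain ⟨⟨k, γ⟩, hγ⟩ := w
  dsimp only at hT hγ ⊢
  have hu (β : Fin n → ℤˣ) (i : Fin n) : β i * γ i * γ i = β i := by
    rw [mul_assoc, Int.units_mul_self, mul_one]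
  have hs (z : ZMod 2) : signZ z * signZ z = 1 := Int.units_mul_self _
  refine Finset.sum_bij' (fun v _ i => v.1.2 i * γ i)
    (fun β hβ => ⟨(k, fun i => β i * γ i), ?_⟩) ?_ ?_ ?_ ?_ ?_
  · simp only [Finset.mem_filter, mem_signPatterns hT] at hβ
    refine ⟨fun i hi => by simp [hβ.1.1 i hi, hγ.1 i hi], ?_⟩
    simp [Finset.prod_mul_distrib, hβ.2, hγ.2]
  · rintro ⟨⟨l, α⟩, hα⟩ hv
    simp only [Finset.mem_filter, Finset.mem_univ, true_and] at hv
    obtain ⟨rfl, hv⟩ := hv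
    simp only [Finset.mem_filter, mem_signPatterns hT]
    refine ⟨⟨fun i hi => mul_eq_one_iff_eq_inv.2 (by rw [hγ.1 i hi, inv_one]; exact hα.1 i hi), hv⟩, ?_⟩
    rw [Finset.prod_mul_distrib, hα.2, hγ.2, hs]
  · intro β hβ
    simp only [Finset.mem_filter, mem_signPatterns hT] at hβ
    simpa [hu] using hβ.1.2
  · rintro ⟨⟨l, α⟩, hα⟩ hv
    simp only [Finset.mem_filter, Finset.mem_univ, true_and] at hv
    obtain ⟨rfl, hv⟩ := hv
    simp [hu]
  · intro β hβ
    simp [hu]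
  · rintro ⟨⟨l, α⟩, hα⟩ hv
    simp only [Finset.mem_filter, Finset.mem_univ, true_and] at hv
    obtain ⟨rfl, hv⟩ := hv
    rfl

/-- The condition on `v` and `w` that the relation for the edge color `({l,k}, δ)` at the entry
`(v, w)` is not trivially `0 = 0`. -/
def colorCompatible {b : Fin m → ZMod 2} (l k : Fin m) (δ : Fin n → ℤˣ)
    (v w : GVertex M b) : Prop :=
  ((v.1.1 = l ∧ w.1.1 = k) ∨ (v.1.1 = k ∧ w.1.1 = l)) ∧ (Sk M l ∩ Sk M k).Nonempty ∧
    (v.1.1 = w.1.1 → ∃ i ∈ Sk M l ∩ Sk M k, δ i ≠ 1)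

theorem colorCompatible_comm {b : Fin m → ZMod 2} {l k : Fin m} {δ : Fin n → ℤˣ}
    {v w : GVertex M b} : colorCompatible l k δ v w ↔ colorCompatible l k δ w v := by
  unfold colorCompatible
  rw [eq_comm (a := v.1.1) (b := w.1.1)]
  tauto

theorem adjC_and_color_iff {b : Fin m → ZMod 2} {l k : Fin m} {δ : Fin n → ℤˣ}
    {v u w : GVertex M b} :
    adjC M b l k δ v u ∧ u.1.1 = w.1.1 ↔ colorCompatible l k δ v w ∧ u.1.1 = w.1.1 ∧
      ∀ i ∈ Sk M l ∩ Sk M k, u.1.2 i * w.1.2 i = δ i * (v.1.2 i * w.1.2 i) := by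
  have key (i : Fin n) : u.1.2 i * w.1.2 i = δ i * (v.1.2 i * w.1.2 i) ↔
      v.1.2 i * u.1.2 i = δ i := by
    rw [← mul_assoc, mul_left_inj, ← mul_left_inj (v.1.2 i), mul_assoc (δ i),
      Int.units_mul_self, mul_one, mul_comm]
  simp only [key, colorCompatible, adjC]
  constructor
  · rintro ⟨⟨h1, h2, h3, h4⟩, h5⟩
    refine ⟨⟨by rwa [← h5], h3, fun hvw => ?_⟩, h5, h4⟩
    by_contra! hδ
    have huv : v.1.1 = u.1.1 := hvw.trans h5.symm
    refine h2 (Subtype.ext (Prod.ext huv (funext fun i => ?_)))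
    have hl : l = v.1.1 := by rcases h1 with ⟨h, -⟩ | ⟨-, h⟩ <;> simp [huv, ← h]
    have hk : k = v.1.1 := by rcases h1 with ⟨-, h⟩ | ⟨h, -⟩ <;> simp [huv, ← h]
    by_cases hi : i ∈ Sk M v.1.1
    · have hi2 : i ∈ Sk M l ∩ Sk M k := by simp [hl, hk, hi]
      have h := h4 i hi2
      rw [hδ i hi2] at h
      rw [eq_inv_of_mul_eq_one_left h, Int.units_inv_eq_self]
    · rw [v.2.1 i hi, u.2.1 i (huv ▸ hi)]
  · rintro ⟨⟨h1, h3, h2⟩, h5, h4⟩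
    refine ⟨⟨by rwa [h5], ?_, h3, h4⟩, h5⟩
    rintro rfl
    obtain ⟨i, hi, hδ⟩ := h2 h5
    exact hδ (by rw [← h4 i hi, Int.units_mul_self])

open Classical in
theorem SolRel.sum_adjMat_mul (hx : SolRel M x) {b : Fin m → ZMod 2} (l k : Fin m)
    (δ : Fin n → ℤˣ) (v w : GVertex M b) :
    (∑ u : GVertex M b, adjMat A M b l k δ v u *
      if u.1.1 = w.1.1 then vproj M x u.1.1 (fun i => u.1.2 i * w.1.2 i) else 0) =
      if colorCompatible l k δ v w then
        sortedProj x (Sk M l ∩ Sk M k) (fun i => δ i * (v.1.2 i * w.1.2 i)) else 0 := by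
  have h (u : GVertex M b) : (adjMat A M b l k δ v u *
      if u.1.1 = w.1.1 then vproj M x u.1.1 (fun i => u.1.2 i * w.1.2 i) else 0) =
      if colorCompatible l k δ v w ∧ u.1.1 = w.1.1 ∧
        ∀ i ∈ Sk M l ∩ Sk M k, u.1.2 i * w.1.2 i = δ i * (v.1.2 i * w.1.2 i) then
        vproj M x u.1.1 (fun i => u.1.2 i * w.1.2 i) else 0 := by
    rw [adjMat, ite_mul, one_mul, zero_mul, ← ite_and]
    exact if_congr adjC_and_color_iff rfl rfl
  simp only [h]
  by_cases hC : colorCompatible l k δ v w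
  · have hT : Sk M l ∩ Sk M k ⊆ Sk M w.1.1 := by
      rcases hC.1 with ⟨-, h⟩ | ⟨-, h⟩ <;> rw [h]
      exacts [Finset.inter_subset_right, Finset.inter_subset_left]
    simp only [hC, true_and, if_true]
    exact hx.sum_vertices w hT _
  · simp [hC]

theorem SolRel.sum_vproj_ite (hx : SolRel M x) {b : Fin m → ZMod 2} (w : GVertex M b) :
    (∑ v : GVertex M b,
      if v.1.1 = w.1.1 then vproj M x v.1.1 (fun i => v.1.2 i * w.1.2 i) else 0) = 1 := by
  simpa [sortedProj] using hx.sum_vertices w (Finset.empty_subset _) 1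

end SolutionGroup

/-- Given a representation `x` of the homogeneous solution group of `Mx = 0` and any
`b ∈ F₂^m`, the matrix `v` with `v_{(l,α),(k,β)} = δ_{lk} · v^{(k)}_{α△β}` is a magic
unitary satisfying the `Qut(G(M,b))` relations. -/
theorem vprojMagicUnitary {m n : ℕ} (M : Matrix (Fin m) (Fin n) (ZMod 2))
    {A : Type*} [NormedRing A] [StarRing A] [CStarRing A] [NormedAlgebra ℂ A]
    [CompleteSpace A]
    (x : Fin n → A) (hx : SolRel M x) (b : Fin m → ZMod 2) :
    IsMagicUnitary (fun v w : GVertex M b =>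
      if v.1.1 = w.1.1 then vproj M x v.1.1 (fun i => v.1.2 i * w.1.2 i) else 0) ∧
    QutRel A M b (fun v w : GVertex M b =>
      if v.1.1 = w.1.1 then vproj M x v.1.1 (fun i => v.1.2 i * w.1.2 i) else 0) := by
  refine ⟨⟨fun v w => ?_, fun v w => ?_, fun v => ?_, hx.sum_vproj_ite⟩,
    fun v w h => if_neg h, fun l k δ v w => ?_⟩
  · dsimp only
    split_ifs
    · exact hx.star_sortedProj _ _
    · exact star_zero A
  · dsimp only
    split_ifs
    · exact hx.sortedProj_mul_self _ _
    · exact mul_zero 0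
  · simp only [vproj_ite_comm v]
    exact hx.sum_vproj_ite v
  · classical
    have h (u : GVertex M b) :
        (if v.1.1 = u.1.1 then vproj M x v.1.1 (fun i => v.1.2 i * u.1.2 i) else 0) *
          adjMat A M b l k δ u w = adjMat A M b l k δ w u *
          if u.1.1 = v.1.1 then vproj M x u.1.1 (fun i => u.1.2 i * v.1.2 i) else 0 := by
      rw [vproj_ite_comm, adjMat_comm, adjMat]
      split_ifs <;> simp
    simp only [h]
    rw [hx.sum_adjMat_mul, hx.sum_adjMat_mul]
    simp only [colorCompatible_comm (v := v), mul_comm (v.1.2 _)]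
end
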